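/- (Barrier estimate for the dual linearized operator.) For every K > 0 and M > 0 there exist constants ε > 0 and C₂₆ > 0, depending only on n, Ω, Ω̃, h, h̃, θ, θ̃, K and M, with the following property. Let f ∈ C²(Ω̄ × closure(Ω̃)) with ‖f‖_{C²} ≤ K satisfy condition (OSC) and sup |D_x f| ≤ ε; let u be a smooth uniformly convex solution of the second boundary value problem with data (f, c) and ũ its Legendre transform; and let η : closure(Ω̃) × Ω̄ → ℝ be a C² function with ‖η‖_{C²} ≤ M. Then the function φ(y) := η(y, ∇ũ(y)) satisfies, for all y ∈ Ω̃, Σ_{i,j} G̃(y)_{ij} ∂_{ij}φ(y) + Σᵢ f_{xᵢ}(∇ũ(y), y) ∂ᵢφ(y) ≤ C₂₆ · trace(G̃(y)), where G̃(y) := (D²ũ(y))⁻¹ · S(y) · (D²ũ(y))⁻¹ is the (positive definite) coefficient matrix of the linearized dual equation. -/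

import Mathlib

open Set MeasureTheory Matrix
open scoped Topology RealInnerProductSpace NNReal

noncomputable section

abbrev Euc (n : ℕ) := EuclideanSpace ℝ (Fin n)

variable {n : ℕ}

/-- Hessian matrix of `u` at `x`. -/
def Hess (u : Euc n → ℝ) (x : Euc n) : Matrix (Fin n) (Fin n) ℝ :=
  fun i j => iteratedFDeriv ℝ 2 u x ![EuclideanSpace.single i 1, EuclideanSpace.single j 1]

/-- `A ≤ B` in the sense of symmetric matrices. -/
def MatLE (A B : Matrix (Fin n) (Fin n) ℝ) : Prop := (B - A).PosSemidef

/-- The Minkowski mean-curvature operator `div (∇u / √(1 - |∇u|²))`. -/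
def MinkDiv (u : Euc n → ℝ) (x : Euc n) : ℝ :=
  ∑ i, fderiv ℝ (fun y => (Real.sqrt (1 - ‖gradient u y‖ ^ 2))⁻¹ * gradient u y i) x
    (EuclideanSpace.single i 1)

/-- The Euclidean mean-curvature operator `div (∇u / √(1 + |∇u|²))`. -/
def EucDiv (u : Euc n → ℝ) (x : Euc n) : ℝ :=
  ∑ i, fderiv ℝ (fun y => (Real.sqrt (1 + ‖gradient u y‖ ^ 2))⁻¹ * gradient u y i) x
    (EuclideanSpace.single i 1)

/-- `S(p) = (1/v)(Iₙ + p pᵀ / v²)`, `v = √(1-|p|²)`. -/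
def Smat (p : Euc n) : Matrix (Fin n) (Fin n) ℝ :=
  (Real.sqrt (1 - ‖p‖ ^ 2))⁻¹ •
    ((1 : Matrix (Fin n) (Fin n) ℝ) +
      (1 - ‖p‖ ^ 2)⁻¹ • Matrix.vecMulVec (fun i => p i) (fun j => p j))

/-- `B(p) = Iₙ + p pᵀ / (v (1 + v))`, `v = √(1-|p|²)`. -/
def Bmat (p : Euc n) : Matrix (Fin n) (Fin n) ℝ :=
  (1 : Matrix (Fin n) (Fin n) ℝ) +
    (Real.sqrt (1 - ‖p‖ ^ 2) * (1 + Real.sqrt (1 - ‖p‖ ^ 2)))⁻¹ •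
      Matrix.vecMulVec (fun i => p i) (fun j => p j)

/-- `A(x) = (1/v)·B(∇u)·D²u·B(∇u)`: its eigenvalues are the principal curvatures. -/
def Amat (u : Euc n → ℝ) (x : Euc n) : Matrix (Fin n) (Fin n) ℝ :=
  (Real.sqrt (1 - ‖gradient u x‖ ^ 2))⁻¹ •
    (Bmat (gradient u x) * Hess u x * Bmat (gradient u x))

/-- supremum of the quadratic form of `A` over the unit sphere (the operator
norm / largest eigenvalue for a positive semidefinite symmetric `A`). -/
def quadSup (A : Matrix (Fin n) (Fin n) ℝ) : ℝ :=
  ⨆ ξ : Metric.sphere (0 : Euc n) 1,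
    (fun i => (ξ : Euc n) i) ⬝ᵥ A.mulVec (fun i => (ξ : Euc n) i)

/-- The domains `Ω = {h̃ > 0}`, `Ω̃ = {h > 0}` are bounded uniformly convex domains
with smooth boundary, described by the defining functions `h̃` and `h`. -/
def DomainSetup (Ω Ωt : Set (Euc n)) (ht h : Euc n → ℝ) (θt θ : ℝ) : Prop :=
  IsOpen Ω ∧ IsOpen Ωt ∧ Bornology.IsBounded Ω ∧ Bornology.IsBounded Ωt ∧
  Ω.Nonempty ∧ Ωt.Nonempty ∧
  ContDiff ℝ (⊤ : ℕ∞) ht ∧ ContDiff ℝ (⊤ : ℕ∞) h ∧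
  Ω = {x | 0 < ht x} ∧ Ωt = {y | 0 < h y} ∧
  (∀ x ∈ frontier Ω, ‖gradient ht x‖ = 1) ∧
  (∀ y ∈ frontier Ωt, ‖gradient h y‖ = 1) ∧
  0 < θt ∧ 0 < θ ∧
  (∀ x : Euc n, MatLE (Hess ht x) ((-θt) • (1 : Matrix (Fin n) (Fin n) ℝ))) ∧
  (∀ y : Euc n, MatLE (Hess h y) ((-θ) • (1 : Matrix (Fin n) (Fin n) ℝ)))

/-- `f ∈ 𝒜`: `f` is `C²` on `Ω̄ × closure Ω̃` and concave in `x`. -/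
def InA (Ω Ωt : Set (Euc n)) (f : Euc n × Euc n → ℝ) : Prop :=
  ContDiffOn ℝ 2 f (closure Ω ×ˢ closure Ωt) ∧
  ∀ p ∈ closure Ωt, ConcaveOn ℝ (closure Ω) (fun x => f (x, p))

/-- Condition (OSC): `osc f ≤ (n/2)(|Ω̃|/|Ω|)^{1/n}`. -/
def OSCcond (Ω Ωt : Set (Euc n)) (f : Euc n × Euc n → ℝ) : Prop :=
  ∀ x ∈ closure Ω, ∀ y ∈ closure Ω, ∀ p ∈ closure Ωt, ∀ q ∈ closure Ωt,
    |f (x, p) - f (y, q)| ≤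
      ((n : ℝ) / 2) * ((volume Ωt).toReal / (volume Ω).toReal) ^ ((1 : ℝ) / n)

/-- `‖f‖_{C²(Ω̄ × closure Ω̃)} ≤ K`. -/
def C2Bound (Ω Ωt : Set (Euc n)) (f : Euc n × Euc n → ℝ) (K : ℝ) : Prop :=
  ContDiffOn ℝ 2 f (closure Ω ×ˢ closure Ωt) ∧
  ∀ z ∈ closure Ω ×ˢ closure Ωt,
    |f z| ≤ K ∧ ‖fderiv ℝ f z‖ ≤ K ∧ ‖iteratedFDeriv ℝ 2 f z‖ ≤ K

/-- `sup |D_x f| ≤ ε` on `Ω̄ × closure Ω̃`. -/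
def DxBound (Ω Ωt : Set (Euc n)) (f : Euc n × Euc n → ℝ) (ε : ℝ) : Prop :=
  ∀ x ∈ closure Ω, ∀ p ∈ closure Ωt, ‖fderiv ℝ (fun x' => f (x', p)) x‖ ≤ ε

/-- `sup |D_{xp} f| ≤ ε` on `Ω̄ × closure Ω̃`. -/
def DxpBound (Ω Ωt : Set (Euc n)) (f : Euc n × Euc n → ℝ) (ε : ℝ) : Prop :=
  ∀ x ∈ closure Ω, ∀ p ∈ closure Ωt,
    ‖fderiv ℝ (fun p' => fderiv ℝ (fun x' => f (x', p')) x) p‖ ≤ ε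

/-- A strictly convex solution of the second boundary value problem. -/
def IsStrictSol (Ω Ωt : Set (Euc n)) (f : Euc n × Euc n → ℝ) (c : ℝ) (u : Euc n → ℝ) : Prop :=
  ContDiffOn ℝ 2 u (closure Ω) ∧
  (∀ x ∈ closure Ω, (Hess u x).PosDef) ∧
  (∀ x ∈ closure Ω, ‖gradient u x‖ < 1) ∧
  (∀ x ∈ Ω, MinkDiv u x = f (x, gradient u x) + c) ∧
  gradient u '' Ω = Ωt

/-- A smooth uniformly convex solution of the second boundary value problem. -/
def IsSmoothSol (Ω Ωt : Set (Euc n)) (f : Euc n × Euc n → ℝ) (c : ℝ) (u : Euc n → ℝ) : Prop :=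
  ContDiffOn ℝ (⊤ : ℕ∞) u (closure Ω) ∧
  (∃ δ : ℝ, 0 < δ ∧ ∀ x ∈ closure Ω, MatLE (δ • (1 : Matrix (Fin n) (Fin n) ℝ)) (Hess u x)) ∧
  (∀ x ∈ closure Ω, ‖gradient u x‖ < 1) ∧
  (∀ x ∈ Ω, MinkDiv u x = f (x, gradient u x) + c) ∧
  gradient u '' Ω = Ωt

/-- A uniformly convex `C^{2}` solution of the second boundary value problem. -/
def IsUCSol (Ω Ωt : Set (Euc n)) (f : Euc n × Euc n → ℝ) (c : ℝ) (u : Euc n → ℝ) : Prop :=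
  ContDiffOn ℝ 2 u (closure Ω) ∧
  (∃ δ : ℝ, 0 < δ ∧ ∀ x ∈ closure Ω, MatLE (δ • (1 : Matrix (Fin n) (Fin n) ℝ)) (Hess u x)) ∧
  (∀ x ∈ closure Ω, ‖gradient u x‖ < 1) ∧
  (∀ x ∈ Ω, MinkDiv u x = f (x, gradient u x) + c) ∧
  gradient u '' Ω = Ωt

/-- A uniformly convex `C^{4,α}` solution of the second boundary value problem
for the Minkowski mean-curvature operator. -/
def IsC4Sol (Ω Ωt : Set (Euc n)) (f : Euc n × Euc n → ℝ) (c : ℝ) (u : Euc n → ℝ)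
    (α : ℝ) : Prop :=
  ContDiffOn ℝ 4 u (closure Ω) ∧
  (∃ C : ℝ≥0, HolderOnWith C (Real.toNNReal α) (fun x => iteratedFDeriv ℝ 4 u x) (closure Ω)) ∧
  (∃ δ : ℝ, 0 < δ ∧ ∀ x ∈ closure Ω, MatLE (δ • (1 : Matrix (Fin n) (Fin n) ℝ)) (Hess u x)) ∧
  (∀ x ∈ closure Ω, ‖gradient u x‖ < 1) ∧
  (∀ x ∈ Ω, MinkDiv u x = f (x, gradient u x) + c) ∧
  gradient u '' Ω = Ωt

/-- A uniformly convex `C^{4,α}` solution of the second boundary value problem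
for the Euclidean mean-curvature operator. -/
def IsC4SolE (Ω Ωt : Set (Euc n)) (f : Euc n × Euc n → ℝ) (c : ℝ) (u : Euc n → ℝ)
    (α : ℝ) : Prop :=
  ContDiffOn ℝ 4 u (closure Ω) ∧
  (∃ C : ℝ≥0, HolderOnWith C (Real.toNNReal α) (fun x => iteratedFDeriv ℝ 4 u x) (closure Ω)) ∧
  (∃ δ : ℝ, 0 < δ ∧ ∀ x ∈ closure Ω, MatLE (δ • (1 : Matrix (Fin n) (Fin n) ℝ)) (Hess u x)) ∧
  (∀ x ∈ Ω, EucDiv u x = f (x, gradient u x) + c) ∧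
  gradient u '' Ω = Ωt

/-- `ũ` is the Legendre transform of `u`. -/
def IsLegendre (Ω Ωt : Set (Euc n)) (u ut : Euc n → ℝ) : Prop :=
  ContDiffOn ℝ (⊤ : ℕ∞) ut (closure Ωt) ∧
  (∀ x ∈ closure Ω, ut (gradient u x) = ⟪x, gradient u x⟫ - u x) ∧
  (∀ x ∈ closure Ω, gradient ut (gradient u x) = x) ∧
  (∀ x ∈ closure Ω, Hess ut (gradient u x) = (Hess u x)⁻¹)

/-! ### Gradients and Hessians in coordinates -/

lemma gradient_apply_eq (u : Euc n → ℝ) (x : Euc n) (k : Fin n) :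
    gradient u x k = fderiv ℝ u x (EuclideanSpace.single k 1) := by
  have h := InnerProductSpace.toDual_symm_apply (𝕜 := ℝ)
    (x := EuclideanSpace.single k (1 : ℝ)) (y := fderiv ℝ u x)
  rw [← h, EuclideanSpace.inner_single_right]
  simp [gradient]

lemma Hess_apply (u : Euc n → ℝ) (x : Euc n) (i j : Fin n) :
    Hess u x i j = fderiv ℝ (fderiv ℝ u) x (EuclideanSpace.single i 1)
      (EuclideanSpace.single j 1) := by
  simp [Hess, iteratedFDeriv_two_apply]

lemma Hess_symm {u : Euc n → ℝ} {x : Euc n} (hu : ContDiffAt ℝ 2 u x) (i j : Fin n) :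
    Hess u x i j = Hess u x j i := by
  rw [Hess_apply, Hess_apply]
  exact hu.isSymmSndFDerivAt (by simp) _ _

lemma contDiffAt_gradient {u : Euc n → ℝ} {x : Euc n} {m k : WithTop ℕ∞}
    (hu : ContDiffAt ℝ k u x) (hm : m + 1 ≤ k) : ContDiffAt ℝ m (gradient u) x := by
  rw [contDiffAt_euclidean]
  intro i
  simp only [gradient_apply_eq]
  exact (hu.fderiv_right hm).clm_apply contDiffAt_const

lemma contDiffAt_Hess {u : Euc n → ℝ} {x : Euc n} {m k : WithTop ℕ∞}
    (hu : ContDiffAt ℝ k u x) (hm : m + 1 + 1 ≤ k) (i j : Fin n) :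
    ContDiffAt ℝ m (fun y => Hess u y i j) x := by
  simp only [Hess_apply]
  exact (((hu.fderiv_right hm).fderiv_right le_rfl).clm_apply contDiffAt_const).clm_apply
    contDiffAt_const

lemma fderiv_apply_coord {E : Type*} [NormedAddCommGroup E] [NormedSpace ℝ E]
    {T : E → Euc n} {x : E} (hT : DifferentiableAt ℝ T x) (a : E) (k : Fin n) :
    fderiv ℝ T x a k = fderiv ℝ (fun y => T y k) x a := by
  have h := ((EuclideanSpace.proj (𝕜 := ℝ) k).hasFDerivAt.comp x hT.hasFDerivAt).fderiv
  have h2 : fderiv ℝ (fun y => T y k) x = (EuclideanSpace.proj (𝕜 := ℝ) k).comp (fderiv ℝ T x) := h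
  rw [h2]
  rfl

lemma fderiv_gradient_apply {u : Euc n → ℝ} {x : Euc n} (hu : ContDiffAt ℝ 2 u x)
    (i k : Fin n) :
    fderiv ℝ (gradient u) x (EuclideanSpace.single i 1) k = Hess u x i k := by
  have hg : DifferentiableAt ℝ (gradient u) x :=
    (contDiffAt_gradient (m := 1) hu (by norm_num)).differentiableAt (by simp)
  have hf : DifferentiableAt ℝ (fderiv ℝ u) x :=
    (hu.fderiv_right (m := 1) (by norm_num)).differentiableAt (by simp)
  rw [fderiv_apply_coord hg, Hess_apply]
  simp only [gradient_apply_eq]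
  rw [fderiv_clm_apply hf (differentiableAt_const _)]
  simp

lemma euc_eq_sum (q : Euc n) : q = ∑ j, q j • EuclideanSpace.single j (1 : ℝ) := by
  ext k
  simp [Finset.sum_apply, Pi.single_apply]

/-- Third derivatives of `u`, as derivatives of the entries of the Hessian, are symmetric. -/
lemma fderiv_Hess_symm {u : Euc n → ℝ} {x : Euc n} (hu : ContDiffAt ℝ 3 u x)
    (i j k : Fin n) :
    fderiv ℝ (fun y => Hess u y j k) x (EuclideanSpace.single i 1) =
      fderiv ℝ (fun y => Hess u y i j) x (EuclideanSpace.single k 1) := by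
  have key : ∀ i j k : Fin n,
      fderiv ℝ (fun y => Hess u y j k) x (EuclideanSpace.single i 1) =
        fderiv ℝ (fun y => Hess u y i k) x (EuclideanSpace.single j 1) := by
    intro i j k
    have hf : ContDiffAt ℝ 2 (fderiv ℝ u) x := hu.fderiv_right (by norm_num)
    have hff : DifferentiableAt ℝ (fderiv ℝ (fderiv ℝ u)) x :=
      (hf.fderiv_right (m := 1) (by norm_num)).differentiableAt (by simp)
    have hs := hf.isSymmSndFDerivAt (by simp) (EuclideanSpace.single i 1)
      (EuclideanSpace.single j 1)
    have h : ∀ a b c : Fin n, fderiv ℝ (fun y => Hess u y b c) x (EuclideanSpace.single a 1) =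
        fderiv ℝ (fderiv ℝ (fderiv ℝ u)) x (EuclideanSpace.single a 1)
          (EuclideanSpace.single b 1) (EuclideanSpace.single c 1) := by
      intro a b c
      simp only [Hess_apply]
      have h1 : DifferentiableAt ℝ
          (fun y => fderiv ℝ (fderiv ℝ u) y (EuclideanSpace.single b 1)) x :=
        hff.clm_apply (differentiableAt_const _)
      rw [fderiv_clm_apply h1 (differentiableAt_const _),
        fderiv_clm_apply hff (differentiableAt_const _)]
      simp
    rw [h, h, hs]
  have hsym : ∀ a b c : Fin n, fderiv ℝ (fun y => Hess u y b c) x (EuclideanSpace.single a 1) =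
      fderiv ℝ (fun y => Hess u y c b) x (EuclideanSpace.single a 1) := by
    intro a b c
    have : (fun y => Hess u y b c) =ᶠ[𝓝 x] (fun y => Hess u y c b) := by
      filter_upwards [(hu.of_le (m := 2) (by norm_num)).eventually (by simp)] with y hy
      exact Hess_symm hy b c
    rw [this.fderiv_eq]
  rw [key i j k, hsym j i k, key j k i, hsym k j i]

/-! ### The matrix `S` and the Minkowski operator -/

lemma det_le_trace_div_pow {A : Matrix (Fin n) (Fin n) ℝ} (hA : A.PosSemidef) (hn : 0 < n) :
    A.det ≤ (A.trace / n) ^ n := by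
  have hn' : (0 : ℝ) < n := by exact_mod_cast hn
  have hev := hA.eigenvalues_nonneg
  rw [hA.1.det_eq_prod_eigenvalues, hA.1.trace_eq_sum_eigenvalues]
  simp only [RCLike.ofReal_real_eq_id, id]
  have h := Real.geom_mean_le_arith_mean Finset.univ (fun _ => (1 : ℝ)) hA.1.eigenvalues
    (by simp) (by simpa using hn') (fun i _ => hev i)
  simp only [Real.rpow_one, Finset.sum_const, Finset.card_univ, Fintype.card_fin, nsmul_eq_mul,
    mul_one, one_mul] at h
  have hp : 0 ≤ ∏ i, hA.1.eigenvalues i := Finset.prod_nonneg fun i _ => hev i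
  calc _ = ((∏ i, hA.1.eigenvalues i) ^ ((n : ℝ)⁻¹)) ^ n :=
        (Real.rpow_inv_natCast_pow hp hn.ne').symm
    _ ≤ _ := pow_le_pow_left₀ (Real.rpow_nonneg hp _) h n

lemma Smat_apply (p : Euc n) (i j : Fin n) :
    Smat p i j = (Real.sqrt (1 - ‖p‖ ^ 2))⁻¹ *
      ((1 : Matrix (Fin n) (Fin n) ℝ) i j + (1 - ‖p‖ ^ 2)⁻¹ * (p i * p j)) := by
  simp [Smat, Matrix.vecMulVec_apply]

lemma Smat_symm (p : Euc n) (i j : Fin n) : Smat p i j = Smat p j i := by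
  rw [Smat_apply, Smat_apply, mul_comm (p i), ← Matrix.transpose_apply (1 : Matrix _ _ ℝ),
    Matrix.transpose_one]

lemma one_sub_norm_sq_pos {p : Euc n} (hp : ‖p‖ < 1) : 0 < 1 - ‖p‖ ^ 2 := by
  nlinarith [norm_nonneg p]

lemma one_le_inv_sqrt {p : Euc n} (hp : ‖p‖ < 1) : 1 ≤ (Real.sqrt (1 - ‖p‖ ^ 2))⁻¹ := by
  have h0 := one_sub_norm_sq_pos hp
  refine (one_le_inv₀ (Real.sqrt_pos.2 h0)).2 (Real.sqrt_le_one.2 ?_)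
  nlinarith [norm_nonneg p]

lemma contDiffAt_Smat {p : Euc n} (hp : ‖p‖ < 1) (m : WithTop ℕ∞) (i j : Fin n) :
    ContDiffAt ℝ m (fun q => Smat q i j) p := by
  simp only [Smat_apply]
  have h0 := one_sub_norm_sq_pos hp
  have hv : ContDiffAt ℝ m (fun q : Euc n => 1 - ‖q‖ ^ 2) p :=
    contDiffAt_const.sub (contDiff_norm_sq ℝ).contDiffAt
  have hc : ∀ k : Fin n, ContDiffAt ℝ m (fun q : Euc n => q k) p := fun k =>
    (EuclideanSpace.proj (𝕜 := ℝ) k).contDiff.contDiffAt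
  exact ((hv.sqrt h0.ne').inv (Real.sqrt_pos.2 h0).ne').mul
    (contDiffAt_const.add ((hv.inv h0.ne').mul ((hc i).mul (hc j))))

/-- `S ≥ I`, tested against positive semidefinite matrices. -/
lemma trace_le_sum_Smat_mul {p : Euc n} (hp : ‖p‖ < 1) {A : Matrix (Fin n) (Fin n) ℝ}
    (hA : A.PosSemidef) : A.trace ≤ ∑ i, ∑ j, Smat p i j * A i j := by
  have h0 := one_sub_norm_sq_pos hp
  have hq := hA.dotProduct_mulVec_nonneg (fun i => p i)
  simp only [dotProduct, Matrix.mulVec, Finset.mul_sum, star_trivial] at hq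
  have htr := hA.trace_nonneg
  have e : ∑ i, ∑ j, Smat p i j * A i j = (Real.sqrt (1 - ‖p‖ ^ 2))⁻¹ *
      (A.trace + (1 - ‖p‖ ^ 2)⁻¹ * ∑ i, ∑ j, p i * (A i j * p j)) := by
    simp only [Smat_apply, mul_add, add_mul, Finset.sum_add_distrib, Finset.mul_sum]
    congr 1
    · simp [Matrix.one_apply, Matrix.trace, Finset.mul_sum]
    · refine Finset.sum_congr rfl fun i _ => Finset.sum_congr rfl fun j _ => by ring
  rw [e]
  have h1 := one_le_inv_sqrt hp
  have h2 : 0 ≤ (1 - ‖p‖ ^ 2)⁻¹ * ∑ i, ∑ j, p i * (A i j * p j) :=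
    mul_nonneg (inv_nonneg.2 h0.le) hq
  nlinarith

/-- `p ↦ p / √(1 - |p|²)` has derivative `S`. -/
lemma hasFDerivAt_inv_sqrt_mul {p : Euc n} (hp : ‖p‖ < 1) (i : Fin n) :
    HasFDerivAt (fun q : Euc n => (Real.sqrt (1 - ‖q‖ ^ 2))⁻¹ * q i)
      (∑ j, Smat p i j • (EuclideanSpace.proj j : Euc n →L[ℝ] ℝ)) p := by
  have h0 := one_sub_norm_sq_pos hp
  have hs := Real.sqrt_pos.2 h0
  have hv : HasFDerivAt (fun q : Euc n => 1 - ‖q‖ ^ 2) (-(2 • innerSL ℝ p)) p :=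
    (hasStrictFDerivAt_norm_sq p).hasFDerivAt.const_sub 1
  have hc : HasFDerivAt (fun q : Euc n => q i) (EuclideanSpace.proj i : Euc n →L[ℝ] ℝ) p :=
    (EuclideanSpace.proj (𝕜 := ℝ) i).hasFDerivAt
  have hsq := hv.sqrt h0.ne'
  have hinv := (hasDerivAt_inv hs.ne').comp_hasFDerivAt p hsq
  refine (hinv.mul hc).congr_fderiv ?_
  ext q
  have hss : Real.sqrt (1 - ‖p‖ ^ 2) ^ 2 = 1 - ‖p‖ ^ 2 := Real.sq_sqrt h0.le
  have hin : inner ℝ p q = ∑ j, p j * q j := by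
    simp [PiLp.inner_apply, mul_comm]
  have e1 : ∑ j, Smat p i j * q j = (Real.sqrt (1 - ‖p‖ ^ 2))⁻¹ *
      (q i + (1 - ‖p‖ ^ 2)⁻¹ * p i * inner ℝ p q) := by
    rw [hin]
    simp only [Smat_apply, mul_add, add_mul, Finset.sum_add_distrib, Finset.mul_sum]
    congr 1
    · simp [Matrix.one_apply]
    · exact Finset.sum_congr rfl fun j _ => by ring
  simp only [_root_.sum_apply, _root_.smul_apply, PiLp.proj_apply,
    smul_eq_mul, e1, _root_.add_apply, _root_.neg_apply,
    innerSL_apply_apply, nsmul_eq_mul, Function.comp_apply]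
  rw [← hss]
  rw [Real.sqrt_sq hs.le]
  field_simp
  push_cast
  ring

lemma MinkDiv_eq {u : Euc n → ℝ} {x : Euc n} (hu : ContDiffAt ℝ 2 u x)
    (hx : ‖gradient u x‖ < 1) :
    MinkDiv u x = ∑ i, ∑ j, Smat (gradient u x) i j * Hess u x i j := by
  have hg : DifferentiableAt ℝ (gradient u) x :=
    (contDiffAt_gradient (m := 1) hu (by norm_num)).differentiableAt (by simp)
  refine Finset.sum_congr rfl fun i _ => ?_
  have h := (hasFDerivAt_inv_sqrt_mul hx i).comp x hg.hasFDerivAt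
  have h' : fderiv ℝ (fun y => (Real.sqrt (1 - ‖gradient u y‖ ^ 2))⁻¹ * gradient u y i) x = _ :=
    h.fderiv
  rw [h']
  simp [fderiv_gradient_apply hu]

/-! ### A lower bound for the Minkowski operator -/

lemma posSemidef_of_smul_one_matLE {A : Matrix (Fin n) (Fin n) ℝ} {δ : ℝ} (hδ : 0 ≤ δ)
    (hA : MatLE (δ • (1 : Matrix (Fin n) (Fin n) ℝ)) A) : A.PosSemidef := by
  have h := Matrix.PosSemidef.add hA (Matrix.PosSemidef.one.smul hδ)
  simpa using h

lemma det_fderiv_gradient {u : Euc n → ℝ} {x : Euc n} (hu : ContDiffAt ℝ 2 u x) :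
    (fderiv ℝ (gradient u) x).det = (Hess u x).det := by
  let b := (EuclideanSpace.basisFun (Fin n) ℝ).toBasis
  have hm : LinearMap.toMatrix b b (fderiv ℝ (gradient u) x : Euc n →ₗ[ℝ] Euc n) =
      (Hess u x)ᵀ := by
    ext i j
    rw [LinearMap.toMatrix_apply, Matrix.transpose_apply, ← fderiv_gradient_apply hu]
    simp [b]
  rw [← Matrix.det_transpose, ← hm, LinearMap.det_toMatrix]

/-- The oscillation condition and the change of variables `y = ∇u(x)` bound the Minkowski mean
curvature of a solution from below. -/
lemma le_MinkDiv {Ω Ωt : Set (Euc n)} (hn : 0 < n) (hΩ : IsOpen Ω) (hΩb : Bornology.IsBounded Ω)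
    (hΩne : Ω.Nonempty) {f : Euc n × Euc n → ℝ} {c : ℝ} {u : Euc n → ℝ}
    (hosc : OSCcond Ω Ωt f) (hu : IsSmoothSol Ω Ωt f c u) {x₀ : Euc n} (hx₀ : x₀ ∈ Ω) :
    ((n : ℝ) / 2) * ((volume Ωt).toReal / (volume Ω).toReal) ^ ((1 : ℝ) / n) ≤
      MinkDiv u x₀ := by
  obtain ⟨hsm, ⟨δ, hδ, hconv⟩, hgr, heq, him⟩ := hu
  have hn' : (0 : ℝ) < n := by exact_mod_cast hn
  have hvol : 0 < (volume Ω).toReal :=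
    ENNReal.toReal_pos (hΩ.measure_pos volume hΩne).ne' hΩb.measure_lt_top.ne
  have hC2 : ∀ x ∈ Ω, ContDiffAt ℝ 2 u x := fun x hx =>
    ((hsm.mono subset_closure).contDiffAt (hΩ.mem_nhds hx)).of_le (WithTop.coe_le_coe.2 (le_top : (2 : ℕ∞) ≤ ⊤))
  have hmem : ∀ x ∈ Ω, gradient u x ∈ closure Ωt := fun x hx =>
    subset_closure (him ▸ mem_image_of_mem _ hx)
  set r := (volume Ωt).toReal / (volume Ω).toReal with hr
  set R := r ^ ((1 : ℝ) / n) with hR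
  have hr0 : 0 ≤ r := by positivity
  by_contra! hlt
  set s := (MinkDiv u x₀ + (n : ℝ) / 2 * R) / n with hs
  have hsR : s < R := by
    rw [hs, div_lt_iff₀ hn']; linarith
  have hdet : ∀ x ∈ Ω, 0 ≤ s ∧ |(fderiv ℝ (gradient u) x).det| ≤ s ^ n := by
    intro x hx
    have hpsd := posSemidef_of_smul_one_matLE hδ.le (hconv x (subset_closure hx))
    have h1 := det_le_trace_div_pow hpsd hn
    have h2 := trace_le_sum_Smat_mul (hgr x (subset_closure hx)) hpsd
    rw [← MinkDiv_eq (hC2 x hx) (hgr x (subset_closure hx))] at h2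
    have h3 := (abs_le.1 (hosc x (subset_closure hx) x₀ (subset_closure hx₀)
      _ (hmem x hx) _ (hmem x₀ hx₀))).2
    have h4 : MinkDiv u x ≤ MinkDiv u x₀ + (n : ℝ) / 2 * R := by
      rw [heq x hx, heq x₀ hx₀]; linarith
    have h5 : (Hess u x).trace / n ≤ s := by
      rw [hs]; gcongr; exact h2.trans h4
    have h6 : 0 ≤ (Hess u x).trace / n := div_nonneg hpsd.trace_nonneg hn'.le
    refine ⟨h6.trans h5, ?_⟩
    rw [det_fderiv_gradient (hC2 x hx), abs_of_nonneg hpsd.det_nonneg]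
    exact h1.trans (pow_le_pow_left₀ h6 h5 n)
  have hs0 : 0 ≤ s := (hdet x₀ hx₀).1
  have hvolt : volume Ωt ≤ ENNReal.ofReal (s ^ n) * volume Ω := by
    rw [← him]
    refine (addHaar_image_le_lintegral_abs_det_fderiv volume hΩ.measurableSet
      (f' := fderiv ℝ (gradient u)) fun x hx => ?_).trans ?_
    · exact ((contDiffAt_gradient (m := 1) (hC2 x hx) (by norm_num)).differentiableAt
        (by simp)).hasFDerivAt.hasFDerivWithinAt
    · rw [← setLIntegral_const]
      exact setLIntegral_mono measurable_const fun x hx =>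
        ENNReal.ofReal_le_ofReal (hdet x hx).2
  have hfin : ENNReal.ofReal (s ^ n) * volume Ω ≠ ⊤ :=
    ENNReal.mul_ne_top ENNReal.ofReal_ne_top hΩb.measure_lt_top.ne
  have h7 := ENNReal.toReal_mono hfin hvolt
  rw [ENNReal.toReal_mul, ENNReal.toReal_ofReal (by positivity)] at h7
  have h8 : s ^ n < R ^ n := pow_lt_pow_left₀ hsR hs0 hn.ne'
  have h9 : R ^ n = r := by
    rw [hR, one_div, Real.rpow_inv_natCast_pow hr0 hn.ne']
  have h10 : r ≤ s ^ n := by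
    rw [hr, div_le_iff₀ hvol]; exact h7
  linarith

/-! ### Derivatives of the dual equation -/

lemma sum_mul_eq_trace (X Y : Matrix (Fin n) (Fin n) ℝ) :
    ∑ i, ∑ j, X i j * Y i j = (Xᵀ * Y).trace := by
  simp only [Matrix.trace, Matrix.diag_apply, Matrix.mul_apply, Matrix.transpose_apply]
  exact Finset.sum_comm

/-- Differentiating `H A = 1` in a direction `e`, tested against a matrix `S`. -/
lemma sum_mul_fderiv_of_mul_eq_one {A H : Euc n → Matrix (Fin n) (Fin n) ℝ}
    {S : Matrix (Fin n) (Fin n) ℝ} {y : Euc n}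
    (hA : ∀ i j, DifferentiableAt ℝ (fun z => A z i j) y)
    (hH : ∀ i j, DifferentiableAt ℝ (fun z => H z i j) y)
    (hHA : ∀ᶠ z in 𝓝 y, H z * A z = 1) (hsym : (A y)ᵀ = A y) (e : Euc n) :
    ∑ i, ∑ j, S i j * fderiv ℝ (fun z => A z i j) y e =
      -∑ i, ∑ j, (A y * S * A y) i j * fderiv ℝ (fun z => H z i j) y e := by
  let A' : Matrix (Fin n) (Fin n) ℝ := Matrix.of fun i j => fderiv ℝ (fun z => A z i j) y e
  let H' : Matrix (Fin n) (Fin n) ℝ := Matrix.of fun i j => fderiv ℝ (fun z => H z i j) y e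
  have hprod : H' * A y + H y * A' = 0 := by
    ext i j
    have hev : (fun z => ∑ k, H z i k * A z k j) =ᶠ[𝓝 y]
        fun _ => (1 : Matrix (Fin n) (Fin n) ℝ) i j := by
      filter_upwards [hHA] with z hz
      rw [← hz, Matrix.mul_apply]
    have h1 : fderiv ℝ (fun z => ∑ k, H z i k * A z k j) y e = 0 := by
      rw [hev.fderiv_eq]; simp
    rw [fderiv_fun_sum fun k _ => (hH i k).fun_mul (hA k j)] at h1
    simp only [fderiv_fun_mul (hH i _) (hA _ j), _root_.sum_apply, _root_.add_apply,
      _root_.smul_apply, smul_eq_mul, Finset.sum_add_distrib] at h1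
    simp only [Matrix.add_apply, Matrix.mul_apply, Matrix.zero_apply, A', H', Matrix.of_apply]
    rw [← h1, add_comm]
    simp only [mul_comm]
  have hinv : A y * H y = 1 := mul_eq_one_comm.1 hHA.self_of_nhds
  have hA' : A' = -(A y * H' * A y) := by
    have h2 : A y * (H' * A y + H y * A') = 0 := by rw [hprod, mul_zero]
    rw [mul_add, ← mul_assoc, ← mul_assoc, hinv, one_mul] at h2
    exact eq_neg_of_add_eq_zero_right h2
  have e1 : ∑ i, ∑ j, S i j * A' i j = -∑ i, ∑ j, (A y * S * A y) i j * H' i j := by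
    rw [sum_mul_eq_trace, sum_mul_eq_trace, hA', Matrix.mul_neg, Matrix.trace_neg,
      Matrix.transpose_mul, Matrix.transpose_mul, hsym, ← mul_assoc, Matrix.trace_mul_comm]
    simp only [mul_assoc]
  exact e1

lemma fderiv_gradient_eq_sum {v : Euc n → ℝ} {y : Euc n} (hv : ContDiffAt ℝ 2 v y) (i : Fin n) :
    fderiv ℝ (gradient v) y (EuclideanSpace.single i 1) =
      ∑ k, Hess v y i k • EuclideanSpace.single k (1 : ℝ) := by
  conv_lhs => rw [euc_eq_sum (fderiv ℝ (gradient v) y (EuclideanSpace.single i 1))]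
  simp only [fderiv_gradient_apply hv]

lemma fderiv_fderiv_gradient_eq_sum {v : Euc n → ℝ} {y : Euc n} (hv : ContDiffAt ℝ 3 v y)
    (i j : Fin n) :
    fderiv ℝ (fderiv ℝ (gradient v)) y (EuclideanSpace.single i 1) (EuclideanSpace.single j 1) =
      ∑ k, fderiv ℝ (fun z => Hess v z i j) y (EuclideanSpace.single k 1) •
        EuclideanSpace.single k (1 : ℝ) := by
  have hT : ContDiffAt ℝ 2 (gradient v) y := contDiffAt_gradient hv (by norm_num)
  have hT' : DifferentiableAt ℝ (fderiv ℝ (gradient v)) y :=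
    (hT.fderiv_right (m := 1) (by norm_num)).differentiableAt (by simp)
  conv_lhs => rw [euc_eq_sum (fderiv ℝ (fderiv ℝ (gradient v)) y (EuclideanSpace.single i 1)
    (EuclideanSpace.single j 1))]
  refine Finset.sum_congr rfl fun k _ => ?_
  congr 1
  have hd : DifferentiableAt ℝ (fun z => fderiv ℝ (gradient v) z (EuclideanSpace.single j 1)) y :=
    hT'.clm_apply (differentiableAt_const _)
  have h1 : fderiv ℝ (fun z => fderiv ℝ (gradient v) z (EuclideanSpace.single j 1)) y
      (EuclideanSpace.single i 1) = fderiv ℝ (fderiv ℝ (gradient v)) y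
        (EuclideanSpace.single i 1) (EuclideanSpace.single j 1) := by
    rw [fderiv_clm_apply hT' (differentiableAt_const _)]
    simp
  have h2 : (fun z => fderiv ℝ (gradient v) z (EuclideanSpace.single j 1) k) =ᶠ[𝓝 y]
      fun z => Hess v z j k := by
    filter_upwards [(hv.of_le (m := 2) (by norm_num)).eventually (by simp)] with z hz
    exact fderiv_gradient_apply hz j k
  rw [← h1, fderiv_apply_coord hd, h2.fderiv_eq, fderiv_Hess_symm hv]

section Composition

variable {η : Euc n × Euc n → ℝ} {T : Euc n → Euc n} {y : Euc n}

lemma fderiv_comp_graph (hη : DifferentiableAt ℝ η (y, T y)) (hT : DifferentiableAt ℝ T y)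
    (a : Euc n) :
    fderiv ℝ (fun z => η (z, T z)) y a = fderiv ℝ η (y, T y) (a, fderiv ℝ T y a) := by
  have h := hη.hasFDerivAt.comp y ((hasFDerivAt_id y).prodMk hT.hasFDerivAt)
  have h' : fderiv ℝ (fun z => η (z, T z)) y = _ := h.fderiv
  rw [h']
  simp

lemma fderiv_fderiv_comp_graph (hη : ContDiff ℝ 2 η) (hT : ContDiffAt ℝ 2 T y) (a b : Euc n) :
    fderiv ℝ (fderiv ℝ (fun z => η (z, T z))) y a b =
      fderiv ℝ (fderiv ℝ η) (y, T y) (a, fderiv ℝ T y a) (b, fderiv ℝ T y b) +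
        fderiv ℝ η (y, T y) (0, fderiv ℝ (fderiv ℝ T) y a b) := by
  have hη1 : Differentiable ℝ η := hη.differentiable (by simp)
  have hη2 : Differentiable ℝ (fderiv ℝ η) :=
    (hη.fderiv_right (m := 1) (by norm_num)).differentiable (by simp)
  have hTd : DifferentiableAt ℝ T y := hT.differentiableAt (by simp)
  have hT' : DifferentiableAt ℝ (fderiv ℝ T) y :=
    (hT.fderiv_right (m := 1) (by norm_num)).differentiableAt (by simp)
  have hφ : ContDiffAt ℝ 2 (fun z => η (z, T z)) y :=
    hη.contDiffAt.comp y (contDiffAt_id.prodMk hT)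
  have hφ' : DifferentiableAt ℝ (fderiv ℝ (fun z => η (z, T z))) y :=
    (hφ.fderiv_right (m := 1) (by norm_num)).differentiableAt (by simp)
  have h1 : fderiv ℝ (fderiv ℝ (fun z => η (z, T z))) y a b =
      fderiv ℝ (fun z => fderiv ℝ (fun z => η (z, T z)) z b) y a := by
    rw [fderiv_clm_apply hφ' (differentiableAt_const _)]
    simp
  have h2 : (fun z => fderiv ℝ (fun z => η (z, T z)) z b) =ᶠ[𝓝 y]
      fun z => fderiv ℝ η (z, T z) (b, fderiv ℝ T z b) := by
    filter_upwards [hT.eventually (by simp)] with z hz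
    exact fderiv_comp_graph (hη1 _) (hz.differentiableAt (by simp)) b
  have hTb : HasFDerivAt (fun z => fderiv ℝ T z b) ((fderiv ℝ (fderiv ℝ T) y).flip b) y := by
    simpa using hT'.hasFDerivAt.clm_apply (hasFDerivAt_const b y)
  have h3 : HasFDerivAt (fun z => fderiv ℝ η (z, T z))
      ((fderiv ℝ (fderiv ℝ η) (y, T y)).comp
        ((ContinuousLinearMap.id ℝ (Euc n)).prod (fderiv ℝ T y))) y :=
    (hη2 (y, T y)).hasFDerivAt.comp y ((hasFDerivAt_id y).prodMk hTd.hasFDerivAt)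
  have h4 := h3.clm_apply ((hasFDerivAt_const b y).prodMk hTb)
  rw [h1, h2.fderiv_eq, h4.fderiv]
  simp [add_comm]

end Composition

/-! ### The operator in terms of bounded quantities -/

/-- Contracting the second derivative of a composition with `∇v` against `G = A S A`,
where `A = H⁻¹`. -/
lemma sum_mul_conj_add {A H S Eyy Eyx Exy Exx : Matrix (Fin n) (Fin n) ℝ} (hHA : H * A = 1)
    (hH : Hᵀ = H) :
    ∑ i, ∑ j, (A * S * A) i j * (Eyy + Eyx * H + H * Exy + H * Exx * H) i j =
      ∑ i, ∑ j, (A * S * A) i j * Eyy i j + ∑ i, ∑ j, (A * S) i j * Eyx i j +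
        ∑ i, ∑ j, (S * A) i j * Exy i j + ∑ i, ∑ j, S i j * Exx i j := by
  have hAH : A * H = 1 := mul_eq_one_comm.1 hHA
  have hA : Aᵀ = A := by
    have h := congrArg Matrix.transpose hHA
    rw [Matrix.transpose_mul, hH, Matrix.transpose_one] at h
    exact left_inv_eq_right_inv h hHA
  have c2 : ∀ X : Matrix (Fin n) (Fin n) ℝ, A * (H * X) = X := fun X => by
    rw [← mul_assoc, hAH, one_mul]
  simp only [sum_mul_eq_trace, Matrix.mul_add, Matrix.trace_add, Matrix.transpose_mul, hA,
    mul_assoc, c2]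
  congr 1
  · congr 2
    rw [Matrix.trace_mul_comm]
    simp only [mul_assoc, hHA, mul_one]
  · rw [Matrix.trace_mul_comm]
    simp only [mul_assoc, hHA, mul_one]

lemma abs_mul_apply_le {X Y : Matrix (Fin n) (Fin n) ℝ} {α β : ℝ} (hX : ∀ i j, |X i j| ≤ α)
    (hY : ∀ i j, |Y i j| ≤ β) (i j : Fin n) : |(X * Y) i j| ≤ n * (α * β) := by
  rw [Matrix.mul_apply]
  refine (Finset.abs_sum_le_sum_abs _ _).trans ?_
  calc _ ≤ ∑ _k : Fin n, α * β := Finset.sum_le_sum fun k _ => by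
        rw [abs_mul]
        exact mul_le_mul (hX i k) (hY k j) (abs_nonneg _) ((abs_nonneg _).trans (hX i k))
    _ = _ := by simp

lemma abs_sum_mul_le {a b : Fin n → ℝ} {α β : ℝ} (ha : ∀ i, |a i| ≤ α) (hb : ∀ i, |b i| ≤ β) :
    |∑ i, a i * b i| ≤ n * (α * β) := by
  refine (Finset.abs_sum_le_sum_abs _ _).trans ?_
  calc _ ≤ ∑ _k : Fin n, α * β := Finset.sum_le_sum fun k _ => by
        rw [abs_mul]
        exact mul_le_mul (ha k) (hb k) (abs_nonneg _) ((abs_nonneg _).trans (ha k))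
    _ = _ := by simp

lemma abs_sum_sum_mul_le {X Y : Matrix (Fin n) (Fin n) ℝ} {α β : ℝ} (hX : ∀ i j, |X i j| ≤ α)
    (hY : ∀ i j, |Y i j| ≤ β) : |∑ i, ∑ j, X i j * Y i j| ≤ n ^ 2 * (α * β) := by
  refine (Finset.abs_sum_le_sum_abs _ _).trans ?_
  calc _ ≤ ∑ _k : Fin n, n * (α * β) := Finset.sum_le_sum fun k _ => abs_sum_mul_le (hX k) (hY k)
    _ = _ := by simp; ring

/-- The quantitative estimate: all terms are controlled by `trace (A S A)`. -/
lemma sum_le_mul_trace {A Eyy Eyx Exy Exx : Matrix (Fin n) (Fin n) ℝ} {p : Euc n}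
    {DS : Fin n → Matrix (Fin n) (Fin n) ℝ} {ηx ηy fx fp : Fin n → ℝ} {σ M K a₀ : ℝ}
    (hn : 0 < n) (hp : ‖p‖ < 1) (hA : Aᵀ = A) (hσ : 0 < σ) (hM : 0 < M) (hK : 0 < K) (ha₀ : 0 < a₀)
    (hS : ∀ i j, |Smat p i j| ≤ σ) (hDS : ∀ k i j, |DS k i j| ≤ σ)
    (hEyy : ∀ i j, |Eyy i j| ≤ M) (hEyx : ∀ i j, |Eyx i j| ≤ M) (hExy : ∀ i j, |Exy i j| ≤ M)
    (hExx : ∀ i j, |Exx i j| ≤ M) (hηx : ∀ i, |ηx i| ≤ M) (hηy : ∀ i, |ηy i| ≤ M)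
    (hfx : ∀ i, |fx i| ≤ K) (hfp : ∀ i, |fp i| ≤ K)
    (hlow : (n : ℝ) ^ 2 * (σ * a₀) ≤ ∑ i, ∑ j, Smat p i j * A i j) :
    ∑ i, ∑ j, (A * Smat p * A) i j * Eyy i j + ∑ i, ∑ j, (A * Smat p) i j * Eyx i j +
        ∑ i, ∑ j, (Smat p * A) i j * Exy i j + ∑ i, ∑ j, Smat p i j * Exx i j +
        ∑ k, ηx k * (∑ i, ∑ j, DS k i j * A i j - fp k) + ∑ i, fx i * ηy i ≤
      (n ^ 4 * σ * M + 3 * n ^ 3 * σ * M / a₀ + (n ^ 2 * σ * M + 2 * n * M * K) / a₀ ^ 2) *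
        (A * Smat p * A).trace := by
  have hn' : (0 : ℝ) < n := by exact_mod_cast hn
  set N := ∑ i, ∑ j, A i j * A i j with hN
  have hAN : ∀ i j, A i j * A i j ≤ N := fun i j =>
    (Finset.single_le_sum (f := fun j => A i j * A i j) (fun j _ => mul_self_nonneg _)
      (Finset.mem_univ j)).trans
      (Finset.single_le_sum (f := fun i => ∑ j, A i j * A i j)
        (fun i _ => Finset.sum_nonneg fun j _ => mul_self_nonneg _) (Finset.mem_univ i))
  have hN0 : 0 ≤ N := Finset.sum_nonneg fun i _ => Finset.sum_nonneg fun j _ => mul_self_nonneg _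
  set a := Real.sqrt N with ha
  have haN : a ^ 2 = N := Real.sq_sqrt hN0
  have ha' : 0 ≤ a := Real.sqrt_nonneg _
  have hAa : ∀ i j, |A i j| ≤ a := fun i j => by
    rw [ha]; exact Real.abs_le_sqrt (by nlinarith [hAN i j])
  have htr : a ^ 2 ≤ (A * Smat p * A).trace := by
    have hpsd : (A * A).PosSemidef := by
      have := Matrix.posSemidef_conjTranspose_mul_self A
      rwa [Matrix.conjTranspose_eq_transpose_of_trivial, hA] at this
    have hSt : (Smat p)ᵀ = Smat p := by ext i j; exact Smat_symm p j i
    have h1 := trace_le_sum_Smat_mul hp hpsd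
    rw [sum_mul_eq_trace, hSt, ← mul_assoc, Matrix.trace_mul_comm (Smat p * A), ← mul_assoc] at h1
    rwa [haN, hN, sum_mul_eq_trace, hA]
  set t := (A * Smat p * A).trace
  have haa : a₀ ≤ a := by
    have h1 := hlow.trans ((le_abs_self _).trans (abs_sum_sum_mul_le hS hAa))
    have h2 : (0 : ℝ) < n ^ 2 * σ := by positivity
    nlinarith
  have hat : a ≤ t / a₀ := by
    rw [le_div_iff₀ ha₀]; nlinarith
  have h1t : 1 ≤ t / a₀ ^ 2 := by
    rw [le_div_iff₀ (by positivity)]; nlinarith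
  have b1 := (le_abs_self _).trans
    (abs_sum_sum_mul_le (abs_mul_apply_le (abs_mul_apply_le hAa hS) hAa) hEyy)
  have b2 := (le_abs_self _).trans (abs_sum_sum_mul_le (abs_mul_apply_le hAa hS) hEyx)
  have b3 := (le_abs_self _).trans (abs_sum_sum_mul_le (abs_mul_apply_le hS hAa) hExy)
  have b4 := (le_abs_self _).trans (abs_sum_sum_mul_le hS hExx)
  have b5 := (le_abs_self _).trans (abs_sum_mul_le (a := ηx)
    (b := fun k => ∑ i, ∑ j, DS k i j * A i j - fp k) (β := n ^ 2 * (σ * a) + K) hηx fun k =>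
      (abs_sub _ _).trans (add_le_add (abs_sum_sum_mul_le (hDS k) hAa) (hfp k)))
  have b6 := (le_abs_self _).trans (abs_sum_mul_le hfx hηy)
  have e1 : n ^ 4 * σ * M * a ^ 2 ≤ n ^ 4 * σ * M * t := by gcongr
  have e2 : 3 * n ^ 3 * σ * M * a ≤ 3 * n ^ 3 * σ * M * (t / a₀) := by gcongr
  have e3 : (n ^ 2 * σ * M + 2 * n * M * K) * 1 ≤
      (n ^ 2 * σ * M + 2 * n * M * K) * (t / a₀ ^ 2) := by gcongr
  have e4 : (n ^ 4 * σ * M + 3 * n ^ 3 * σ * M / a₀ +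
      (n ^ 2 * σ * M + 2 * n * M * K) / a₀ ^ 2) * t =
      n ^ 4 * σ * M * t + 3 * n ^ 3 * σ * M * (t / a₀) +
        (n ^ 2 * σ * M + 2 * n * M * K) * (t / a₀ ^ 2) := by ring
  rw [e4]
  nlinarith

/-- `S` and its first derivatives are bounded on compact subsets of the unit ball. -/
lemma exists_bound_Smat {s : Set (Euc n)} (hs : IsCompact s) (hb : s ⊆ Metric.ball 0 1) :
    ∃ σ : ℝ, 0 < σ ∧ ∀ p ∈ s, (∀ i j, |Smat p i j| ≤ σ) ∧
      ∀ k i j, |fderiv ℝ (fun q => Smat q i j) p (EuclideanSpace.single k 1)| ≤ σ := by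
  have hlt : ∀ p ∈ s, ‖p‖ < 1 := fun p hp => by simpa using hb hp
  have h1 : ∀ i j, ∃ C, ∀ p ∈ s, ‖Smat p i j‖ ≤ C := fun i j =>
    hs.exists_bound_of_continuousOn fun p hp =>
      (contDiffAt_Smat (hlt p hp) 0 i j).continuousAt.continuousWithinAt
  have h2 : ∀ k i j, ∃ C, ∀ p ∈ s,
      ‖fderiv ℝ (fun q => Smat q i j) p (EuclideanSpace.single k 1)‖ ≤ C := fun k i j =>
    hs.exists_bound_of_continuousOn fun p hp =>
      ((((contDiffAt_Smat (hlt p hp) 1 i j).fderiv_right (m := 0) (by norm_num)).clm_apply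
        contDiffAt_const).continuousAt).continuousWithinAt
  choose C₁ hC₁ using h1
  choose C₂ hC₂ using h2
  have hle₁ : ∀ i j, C₁ i j ≤ ∑ i, ∑ j, |C₁ i j| := fun i j =>
    (le_abs_self _).trans ((Finset.single_le_sum (f := fun j => |C₁ i j|)
      (fun j _ => abs_nonneg _) (Finset.mem_univ j)).trans
      (Finset.single_le_sum (f := fun i => ∑ j, |C₁ i j|)
        (fun i _ => Finset.sum_nonneg fun j _ => abs_nonneg _) (Finset.mem_univ i)))
  have hle₂ : ∀ k i j, C₂ k i j ≤ ∑ k, ∑ i, ∑ j, |C₂ k i j| := fun k i j =>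
    (le_abs_self _).trans ((Finset.single_le_sum (f := fun j => |C₂ k i j|)
      (fun j _ => abs_nonneg _) (Finset.mem_univ j)).trans
      ((Finset.single_le_sum (f := fun i => ∑ j, |C₂ k i j|)
        (fun i _ => Finset.sum_nonneg fun j _ => abs_nonneg _) (Finset.mem_univ i)).trans
      (Finset.single_le_sum (f := fun k => ∑ i, ∑ j, |C₂ k i j|)
        (fun k _ => Finset.sum_nonneg fun i _ => Finset.sum_nonneg fun j _ => abs_nonneg _)
        (Finset.mem_univ k))))
  have hp₁ : 0 ≤ ∑ i, ∑ j, |C₁ i j| :=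
    Finset.sum_nonneg fun i _ => Finset.sum_nonneg fun j _ => abs_nonneg _
  have hp₂ : 0 ≤ ∑ k, ∑ i, ∑ j, |C₂ k i j| :=
    Finset.sum_nonneg fun k _ => Finset.sum_nonneg fun i _ => Finset.sum_nonneg fun j _ =>
      abs_nonneg _
  refine ⟨∑ i, ∑ j, |C₁ i j| + ∑ k, ∑ i, ∑ j, |C₂ k i j| + 1, by positivity, fun p hp =>
    ⟨fun i j => ?_, fun k i j => ?_⟩⟩
  · have := hC₁ i j p hp
    rw [Real.norm_eq_abs] at this
    linarith [hle₁ i j]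
  · have := hC₂ k i j p hp
    rw [Real.norm_eq_abs] at this
    linarith [hle₂ k i j]

lemma Hess_comp_gradient {η : Euc n × Euc n → ℝ} {v : Euc n → ℝ} {y : Euc n}
    (hη : ContDiff ℝ 2 η) (hv : ContDiffAt ℝ 3 v y) (i j : Fin n) :
    Hess (fun z => η (z, gradient v z)) y i j =
      (Matrix.of (fun i j => fderiv ℝ (fderiv ℝ η) (y, gradient v y)
            (EuclideanSpace.single i 1, 0) (EuclideanSpace.single j 1, 0)) +
          Matrix.of (fun i j => fderiv ℝ (fderiv ℝ η) (y, gradient v y)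
            (EuclideanSpace.single i 1, 0) (0, EuclideanSpace.single j 1)) * Hess v y +
          Hess v y * Matrix.of (fun i j => fderiv ℝ (fderiv ℝ η) (y, gradient v y)
            (0, EuclideanSpace.single i 1) (EuclideanSpace.single j 1, 0)) +
          Hess v y * Matrix.of (fun i j => fderiv ℝ (fderiv ℝ η) (y, gradient v y)
            (0, EuclideanSpace.single i 1) (0, EuclideanSpace.single j 1)) * Hess v y) i j +
        ∑ k, fderiv ℝ η (y, gradient v y) (0, EuclideanSpace.single k 1) *
          fderiv ℝ (fun z => Hess v z i j) y (EuclideanSpace.single k 1) := by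
  have hv2 : ContDiffAt ℝ 2 v y := hv.of_le (by norm_num)
  have hT : ContDiffAt ℝ 2 (gradient v) y := contDiffAt_gradient hv (by norm_num)
  have hsplit : ∀ a b : Euc n, (a, b) = ContinuousLinearMap.inl ℝ (Euc n) (Euc n) a +
      ContinuousLinearMap.inr ℝ (Euc n) (Euc n) b := by simp
  have hinl : ∀ a : Euc n, (a, (0 : Euc n)) = ContinuousLinearMap.inl ℝ (Euc n) (Euc n) a := by
    simp
  have hinr : ∀ a : Euc n, ((0 : Euc n), a) = ContinuousLinearMap.inr ℝ (Euc n) (Euc n) a := by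
    simp
  rw [Hess_apply, fderiv_fderiv_comp_graph hη hT, fderiv_gradient_eq_sum hv2,
    fderiv_gradient_eq_sum hv2, fderiv_fderiv_gradient_eq_sum hv]
  generalize (y, gradient v y) = w
  rw [hsplit _ (∑ k, Hess v y i k • _), hsplit _ (∑ k, Hess v y j k • _)]
  simp only [hinl, hinr, map_add, map_sum, map_smul, _root_.add_apply, _root_.sum_apply,
    _root_.smul_apply, smul_eq_mul, Matrix.add_apply, Matrix.mul_apply, Matrix.of_apply,
    Finset.sum_mul]
  congr 1
  · have hs : ∀ k, Hess v y j k = Hess v y k j := fun k => Hess_symm hv2 j k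
    simp only [hs, mul_comm (Hess v y _ j), add_mul, Finset.sum_add_distrib, Finset.sum_mul]
    ring
  · exact Finset.sum_congr rfl fun k _ => mul_comm _ _

lemma fderiv_comp_gradient {η : Euc n × Euc n → ℝ} {v : Euc n → ℝ} {y : Euc n}
    (hη : ContDiff ℝ 2 η) (hv : ContDiffAt ℝ 3 v y) (i : Fin n) :
    fderiv ℝ (fun z => η (z, gradient v z)) y (EuclideanSpace.single i 1) =
      fderiv ℝ η (y, gradient v y) (EuclideanSpace.single i 1, 0) +
        ∑ k, Hess v y i k * fderiv ℝ η (y, gradient v y) (0, EuclideanSpace.single k 1) := by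
  have hv2 : ContDiffAt ℝ 2 v y := hv.of_le (by norm_num)
  have hT : DifferentiableAt ℝ (gradient v) y :=
    (contDiffAt_gradient (m := 1) hv2 (by norm_num)).differentiableAt (by simp)
  have hsplit : ∀ a b : Euc n, (a, b) = (a, (0 : Euc n)) +
      ContinuousLinearMap.inr ℝ (Euc n) (Euc n) b := by simp
  rw [fderiv_comp_graph (hη.differentiable (by simp) _) hT, fderiv_gradient_eq_sum hv2]
  generalize (y, gradient v y) = w
  rw [hsplit _ (∑ k, _)]
  simp only [map_add, map_sum, map_smul, smul_eq_mul, ContinuousLinearMap.inr_apply]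

/-- The dual equation `∑ S(y)ᵢⱼ (D²v(y))⁻¹ᵢⱼ = f(∇v(y), y) + c`, differentiated in the direction
`eₖ`. -/
lemma fderiv_dual_equation {f : Euc n × Euc n → ℝ} {c : ℝ} {u v : Euc n → ℝ} {y : Euc n}
    (hy : ‖y‖ < 1) (hf : DifferentiableAt ℝ f (gradient v y, y))
    (hu : ContDiffAt ℝ 3 u (gradient v y)) (hv : ContDiffAt ℝ 3 v y)
    (hinv : ∀ᶠ z in 𝓝 y, Hess v z * Hess u (gradient v z) = 1)
    (heq : ∀ᶠ z in 𝓝 y, ∑ i, ∑ j, Smat z i j * Hess u (gradient v z) i j =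
      f (gradient v z, z) + c) (k : Fin n) :
    ∑ i, ∑ j, (Hess u (gradient v y) * Smat y * Hess u (gradient v y)) i j *
        fderiv ℝ (fun z => Hess v z i j) y (EuclideanSpace.single k 1) =
      ∑ i, ∑ j, fderiv ℝ (fun z => Smat z i j) y (EuclideanSpace.single k 1) *
          Hess u (gradient v y) i j -
        (∑ l, Hess v y k l * fderiv ℝ f (gradient v y, y) (EuclideanSpace.single l 1, 0) +
          fderiv ℝ f (gradient v y, y) (0, EuclideanSpace.single k 1)) := by
  have hv2 : ContDiffAt ℝ 2 v y := hv.of_le (by norm_num)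
  have hu2 : ContDiffAt ℝ 2 u (gradient v y) := hu.of_le (by norm_num)
  have hTc : ContDiffAt ℝ 1 (gradient v) y := contDiffAt_gradient hv2 (by norm_num)
  have hT : DifferentiableAt ℝ (gradient v) y := hTc.differentiableAt (by simp)
  have hH : ∀ i j, DifferentiableAt ℝ (fun z => Hess v z i j) y := fun i j =>
    (contDiffAt_Hess (m := 1) hv (by norm_num) i j).differentiableAt (by simp)
  have hA : ∀ i j, DifferentiableAt ℝ (fun z => Hess u (gradient v z) i j) y := fun i j =>
    ((contDiffAt_Hess (m := 1) hu (by norm_num) i j).differentiableAt (by simp)).comp y hT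
  have hS : ∀ i j, DifferentiableAt ℝ (fun z => Smat z i j) y := fun i j =>
    (contDiffAt_Smat hy 1 i j).differentiableAt (by simp)
  have hsym : (Hess u (gradient v y))ᵀ = Hess u (gradient v y) := by
    ext i j; exact Hess_symm hu2 j i
  have h1 := sum_mul_fderiv_of_mul_eq_one (S := Smat y) (A := fun z => Hess u (gradient v z))
    hA hH hinv hsym (EuclideanSpace.single k 1)
  have h2 : fderiv ℝ (fun z => ∑ i, ∑ j, Smat z i j * Hess u (gradient v z) i j) y
      (EuclideanSpace.single k 1) =
      ∑ i, ∑ j, Smat y i j * fderiv ℝ (fun z => Hess u (gradient v z) i j) y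
          (EuclideanSpace.single k 1) +
        ∑ i, ∑ j, fderiv ℝ (fun z => Smat z i j) y (EuclideanSpace.single k 1) *
          Hess u (gradient v y) i j := by
    rw [fderiv_fun_sum fun i _ => DifferentiableAt.fun_sum fun j _ => (hS i j).fun_mul (hA i j)]
    simp only [fderiv_fun_sum fun j _ => (hS _ j).fun_mul (hA _ j), fderiv_fun_mul (hS _ _) (hA _ _),
      _root_.sum_apply, _root_.add_apply, _root_.smul_apply, smul_eq_mul, Finset.sum_add_distrib,
      mul_comm (Hess u _ _ _)]
  have h3 : fderiv ℝ (fun z => f (gradient v z, z) + c) y (EuclideanSpace.single k 1) =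
      ∑ l, Hess v y k l * fderiv ℝ f (gradient v y, y) (EuclideanSpace.single l 1, 0) +
          fderiv ℝ f (gradient v y, y) (0, EuclideanSpace.single k 1) := by
    have h4 := (HasFDerivAt.comp (g := f) (f := fun z => (gradient v z, z)) y hf.hasFDerivAt
      (hT.hasFDerivAt.prodMk (hasFDerivAt_id y))).add_const c
    have h5 : fderiv ℝ (fun z => f (gradient v z, z) + c) y = _ := h4.fderiv
    have hsplit : ∀ a b : Euc n, (a, b) =
        ContinuousLinearMap.inl ℝ (Euc n) (Euc n) a + ((0 : Euc n), b) := by simp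
    rw [h5, ContinuousLinearMap.comp_apply, ContinuousLinearMap.prod_apply,
      fderiv_gradient_eq_sum hv2]
    generalize (gradient v y, y) = w
    rw [hsplit (∑ k, _)]
    simp only [map_add, map_sum, map_smul, smul_eq_mul, ContinuousLinearMap.inl_apply,
      ContinuousLinearMap.id_apply]
  rw [Filter.EventuallyEq.fderiv_eq heq, h3, h1] at h2
  linarith

/-- The linearized dual operator applied to `η(y, ∇v(y))`: the third derivatives of `v` cancel
through the dual equation, and so do the terms containing `D_x f` and `D²v`. -/
lemma dual_operator_eq {f η : Euc n × Euc n → ℝ} {c : ℝ} {u v : Euc n → ℝ} {y : Euc n}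
    (hy : ‖y‖ < 1) (hf : DifferentiableAt ℝ f (gradient v y, y))
    (hu : ContDiffAt ℝ 3 u (gradient v y)) (hv : ContDiffAt ℝ 3 v y)
    (hinv : ∀ᶠ z in 𝓝 y, Hess v z * Hess u (gradient v z) = 1)
    (heq : ∀ᶠ z in 𝓝 y, ∑ i, ∑ j, Smat z i j * Hess u (gradient v z) i j =
      f (gradient v z, z) + c) (hη : ContDiff ℝ 2 η)
    {A Eyy Eyx Exy Exx : Matrix (Fin n) (Fin n) ℝ} (hA : A = Hess u (gradient v y))
    (hEyy : Eyy = Matrix.of fun i j => fderiv ℝ (fderiv ℝ η) (y, gradient v y)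
      (EuclideanSpace.single i 1, 0) (EuclideanSpace.single j 1, 0))
    (hEyx : Eyx = Matrix.of fun i j => fderiv ℝ (fderiv ℝ η) (y, gradient v y)
      (EuclideanSpace.single i 1, 0) (0, EuclideanSpace.single j 1))
    (hExy : Exy = Matrix.of fun i j => fderiv ℝ (fderiv ℝ η) (y, gradient v y)
      (0, EuclideanSpace.single i 1) (EuclideanSpace.single j 1, 0))
    (hExx : Exx = Matrix.of fun i j => fderiv ℝ (fderiv ℝ η) (y, gradient v y)
      (0, EuclideanSpace.single i 1) (0, EuclideanSpace.single j 1)) :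
    ∑ i, ∑ j, (A * Smat y * A) i j * Hess (fun z => η (z, gradient v z)) y i j +
        ∑ i, fderiv ℝ f (gradient v y, y) (EuclideanSpace.single i 1, 0) *
          fderiv ℝ (fun z => η (z, gradient v z)) y (EuclideanSpace.single i 1) =
      ∑ i, ∑ j, (A * Smat y * A) i j * Eyy i j + ∑ i, ∑ j, (A * Smat y) i j * Eyx i j +
        ∑ i, ∑ j, (Smat y * A) i j * Exy i j + ∑ i, ∑ j, Smat y i j * Exx i j +
        ∑ k, fderiv ℝ η (y, gradient v y) (0, EuclideanSpace.single k 1) *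
          (∑ i, ∑ j, fderiv ℝ (fun z => Smat z i j) y (EuclideanSpace.single k 1) * A i j -
            fderiv ℝ f (gradient v y, y) (0, EuclideanSpace.single k 1)) +
        ∑ i, fderiv ℝ f (gradient v y, y) (EuclideanSpace.single i 1, 0) *
          fderiv ℝ η (y, gradient v y) (EuclideanSpace.single i 1, 0) := by
  have hv2 : ContDiffAt ℝ 2 v y := hv.of_le (by norm_num)
  have hHt : (Hess v y)ᵀ = Hess v y := by ext i j; exact Hess_symm hv2 j i
  have hHA : Hess v y * A = 1 := by rw [hA]; exact hinv.self_of_nhds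
  have hdual := fderiv_dual_equation hy hf hu hv hinv heq
  rw [← hA] at hdual
  have hHess : ∀ i j, Hess (fun z => η (z, gradient v z)) y i j =
      (Eyy + Eyx * Hess v y + Hess v y * Exy + Hess v y * Exx * Hess v y) i j +
        ∑ k, fderiv ℝ η (y, gradient v y) (0, EuclideanSpace.single k 1) *
          fderiv ℝ (fun z => Hess v z i j) y (EuclideanSpace.single k 1) := by
    rw [hEyy, hEyx, hExy, hExx]
    exact Hess_comp_gradient hη hv
  have hswap : ∀ (G : Matrix (Fin n) (Fin n) ℝ) (b : Fin n → ℝ)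
      (D : Fin n → Matrix (Fin n) (Fin n) ℝ),
      ∑ i, ∑ j, G i j * ∑ k, b k * D k i j = ∑ k, b k * ∑ i, ∑ j, G i j * D k i j := by
    intro G b D
    simp only [Finset.mul_sum]
    rw [Finset.sum_comm_cycle]
    refine Finset.sum_congr rfl fun k _ => Finset.sum_congr rfl fun i _ =>
      Finset.sum_congr rfl fun j _ => by ring
  have hfirst : ∑ i, fderiv ℝ f (gradient v y, y) (EuclideanSpace.single i 1, 0) *
      ∑ k, Hess v y i k * fderiv ℝ η (y, gradient v y) (0, EuclideanSpace.single k 1) =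
      ∑ k, fderiv ℝ η (y, gradient v y) (0, EuclideanSpace.single k 1) *
        ∑ l, Hess v y k l *
          fderiv ℝ f (gradient v y, y) (EuclideanSpace.single l 1, 0) := by
    simp only [Finset.mul_sum]
    rw [Finset.sum_comm]
    refine Finset.sum_congr rfl fun k _ => Finset.sum_congr rfl fun l _ => ?_
    rw [Hess_symm hv2 l k]
    ring
  have hthird := hswap (A * Smat y * A)
    (fun k => fderiv ℝ η (y, gradient v y) (0, EuclideanSpace.single k 1))
    (fun k i j => fderiv ℝ (fun z => Hess v z i j) y (EuclideanSpace.single k 1))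
  simp only [hdual] at hthird
  simp only [hHess, mul_add, Finset.sum_add_distrib, fderiv_comp_gradient hη hv]
  have hconj := sum_mul_conj_add (A := A) (S := Smat y) (Eyy := Eyy) (Eyx := Eyx) (Exy := Exy)
    (Exx := Exx) hHA hHt
  rw [hthird, hfirst, hconj]
  simp only [mul_sub, mul_add, Finset.sum_sub_distrib, Finset.sum_add_distrib]
  ring

lemma IsLegendre.gradient_inverse {Ω Ωt : Set (Euc n)} {f : Euc n × Euc n → ℝ} {c : ℝ}
    {u ut : Euc n → ℝ} (hsol : IsSmoothSol Ω Ωt f c u) (hleg : IsLegendre Ω Ωt u ut)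
    {y : Euc n} (hy : y ∈ Ωt) :
    gradient ut y ∈ Ω ∧ gradient u (gradient ut y) = y ∧
      (Hess ut y)⁻¹ = Hess u (gradient ut y) ∧ Hess ut y * Hess u (gradient ut y) = 1 := by
  obtain ⟨-, ⟨δ, hδ, hconv⟩, -, -, him⟩ := hsol
  obtain ⟨-, -, hgrad, hHess⟩ := hleg
  rw [← him] at hy
  obtain ⟨x, hx, rfl⟩ := hy
  have hxc := subset_closure hx
  have hpd : (Hess u x).PosDef := by
    have h := (Matrix.PosDef.one.smul hδ).add_posSemidef (hconv x hxc)
    simpa using h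
  have hdet : IsUnit (Hess u x).det := (Matrix.isUnit_iff_isUnit_det _).1 hpd.isUnit
  rw [hgrad x hxc, hHess x hxc]
  exact ⟨hx, rfl, Matrix.nonsing_inv_nonsing_inv _ hdet, Matrix.nonsing_inv_mul _ hdet⟩

lemma fderiv_comp_prodMk_left {f : Euc n × Euc n → ℝ} {x y : Euc n}
    (hf : DifferentiableAt ℝ f (x, y)) (a : Euc n) :
    fderiv ℝ (fun x' => f (x', y)) x a = fderiv ℝ f (x, y) (a, 0) := by
  have h := HasFDerivAt.comp (g := f) (f := fun x' => (x', y)) x hf.hasFDerivAt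
    (hasFDerivAt_prodMk_left x y)
  have h' : fderiv ℝ (fun x' => f (x', y)) x = _ := h.fderiv
  rw [h']
  simp

lemma abs_fderiv_le_of_norm_le {E : Type*} [NormedAddCommGroup E] [NormedSpace ℝ E]
    {g : E → ℝ} {z : E} {C : ℝ} (h : ‖fderiv ℝ g z‖ ≤ C) {a : E} (ha : ‖a‖ = 1) :
    |fderiv ℝ g z a| ≤ C := by
  have := (fderiv ℝ g z).le_opNorm a
  rw [ha, mul_one, Real.norm_eq_abs] at this
  exact this.trans h

lemma abs_fderiv_fderiv_le_of_norm_le {E : Type*} [NormedAddCommGroup E] [NormedSpace ℝ E]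
    {g : E → ℝ} {z : E} {C : ℝ} (h : ‖iteratedFDeriv ℝ 2 g z‖ ≤ C) {a b : E} (ha : ‖a‖ = 1)
    (hb : ‖b‖ = 1) : |fderiv ℝ (fderiv ℝ g) z a b| ≤ C := by
  have := (iteratedFDeriv ℝ 2 g z).le_opNorm ![a, b]
  rw [iteratedFDeriv_two_apply] at this
  simp [Fin.prod_univ_two, ha, hb] at this
  exact this.trans h

theorem statement_15 {n : ℕ} (hn : 2 ≤ n)
    (Ω Ωt : Set (Euc n)) (ht h : Euc n → ℝ) (θt θ : ℝ)
    (hdom : DomainSetup Ω Ωt ht h θt θ)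
    (hball : closure Ωt ⊆ Metric.ball (0 : Euc n) 1)
    :
    ∀ K M : ℝ, 0 < K → 0 < M →
      ∃ ε C₂₆ : ℝ, 0 < ε ∧ 0 < C₂₆ ∧
        ∀ f : Euc n × Euc n → ℝ, C2Bound Ω Ωt f K → OSCcond Ω Ωt f → DxBound Ω Ωt f ε →
        ∀ (c : ℝ) (u ut : Euc n → ℝ), IsSmoothSol Ω Ωt f c u → IsLegendre Ω Ωt u ut →
        ∀ η : Euc n × Euc n → ℝ, ContDiff ℝ 2 η →
          (∀ z ∈ closure Ωt ×ˢ closure Ω,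
              |η z| ≤ M ∧ ‖fderiv ℝ η z‖ ≤ M ∧ ‖iteratedFDeriv ℝ 2 η z‖ ≤ M) →
        ∀ y ∈ Ωt,
          (∑ i, ∑ j, ((Hess ut y)⁻¹ * Smat y * (Hess ut y)⁻¹) i j *
                Hess (fun y' => η (y', gradient ut y')) y i j) +
            (∑ i, fderiv ℝ (fun x' => f (x', y)) (gradient ut y) (EuclideanSpace.single i 1) *
                fderiv ℝ (fun y' => η (y', gradient ut y')) y (EuclideanSpace.single i 1)) ≤
          C₂₆ * ((Hess ut y)⁻¹ * Smat y * (Hess ut y)⁻¹).trace := by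
  intro K M hK hM
  obtain ⟨hΩ, hΩt, hΩb, hΩtb, hΩne, hΩtne, -⟩ := hdom
  have hn0 : 0 < n := by omega
  have hn' : (0 : ℝ) < n := by exact_mod_cast hn0
  obtain ⟨σ, hσ, hSσ⟩ := exists_bound_Smat hΩtb.isCompact_closure hball
  have hvol : 0 < (volume Ω).toReal :=
    ENNReal.toReal_pos (hΩ.measure_pos volume hΩne).ne' hΩb.measure_lt_top.ne
  have hvolt : 0 < (volume Ωt).toReal :=
    ENNReal.toReal_pos (hΩt.measure_pos volume hΩtne).ne' hΩtb.measure_lt_top.ne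
  set R := ((volume Ωt).toReal / (volume Ω).toReal) ^ ((1 : ℝ) / n) with hR
  have hR0 : 0 < R := Real.rpow_pos_of_pos (div_pos hvolt hvol) _
  set a₀ := R / (2 * n * σ) with ha₀
  have ha₀0 : 0 < a₀ := by positivity
  refine ⟨1, n ^ 4 * σ * M + 3 * n ^ 3 * σ * M / a₀ +
    (n ^ 2 * σ * M + 2 * n * M * K) / a₀ ^ 2, one_pos, by positivity, ?_⟩
  intro f hfK hosc _ c u ut hsol hleg η hη hηM y hy
  have hinv := fun z (hz : z ∈ Ωt) => hleg.gradient_inverse hsol hz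
  obtain ⟨hxΩ, -, hGA, -⟩ := hinv y hy
  have hyc : y ∈ closure Ωt := subset_closure hy
  have hxc : gradient ut y ∈ closure Ω := subset_closure hxΩ
  have hylt : ‖y‖ < 1 := by simpa using hball hyc
  have hle3 : (3 : WithTop ℕ∞) ≤ ((⊤ : ℕ∞) : WithTop ℕ∞) :=
    WithTop.coe_le_coe.2 (le_top : (3 : ℕ∞) ≤ ⊤)
  have hu3 : ∀ x ∈ Ω, ContDiffAt ℝ 3 u x := fun x hx =>
    ((hsol.1.mono subset_closure).contDiffAt (hΩ.mem_nhds hx)).of_le hle3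
  have hv3 : ContDiffAt ℝ 3 ut y :=
    ((hleg.1.mono subset_closure).contDiffAt (hΩt.mem_nhds hy)).of_le hle3
  have hfd : DifferentiableAt ℝ f (gradient ut y, y) :=
    ((hfK.1.mono (prod_mono subset_closure subset_closure)).contDiffAt
      ((hΩ.prod hΩt).mem_nhds ⟨hxΩ, hy⟩)).differentiableAt (by simp)
  have hmink : ∀ z ∈ Ωt, MinkDiv u (gradient ut z) =
      ∑ i, ∑ j, Smat z i j * Hess u (gradient ut z) i j := by
    intro z hz
    obtain ⟨hx, hg, -⟩ := hinv z hz
    have h := MinkDiv_eq ((hu3 _ hx).of_le (by norm_num)) (hsol.2.2.1 _ (subset_closure hx))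
    rwa [hg] at h
  have heq : ∀ z ∈ Ωt, ∑ i, ∑ j, Smat z i j * Hess u (gradient ut z) i j =
      f (gradient ut z, z) + c := by
    intro z hz
    obtain ⟨hx, hg, -⟩ := hinv z hz
    have h := hsol.2.2.2.1 _ hx
    rwa [hg, hmink z hz] at h
  have hnhds := hΩt.mem_nhds hy
  have hlow : (n : ℝ) ^ 2 * (σ * a₀) ≤
      ∑ i, ∑ j, Smat y i j * Hess u (gradient ut y) i j := by
    rw [← hmink y hy]
    refine le_trans (le_of_eq ?_) (le_MinkDiv hn0 hΩ hΩb hΩne hosc hsol hxΩ)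
    rw [← hR, ha₀]
    field_simp
  have hsym : (Hess u (gradient ut y))ᵀ = Hess u (gradient ut y) := by
    ext i j; exact Hess_symm ((hu3 _ hxΩ).of_le (by norm_num)) j i
  obtain ⟨-, hη1, hη2⟩ := hηM (y, gradient ut y) ⟨hyc, hxc⟩
  obtain ⟨-, hf1, -⟩ := hfK.2 (gradient ut y, y) ⟨hxc, hyc⟩
  have hl : ∀ i : Fin n, ‖((EuclideanSpace.single i (1 : ℝ), 0) : Euc n × Euc n)‖ = 1 := by
    simp [Prod.norm_def]
  have hr : ∀ i : Fin n, ‖((0, EuclideanSpace.single i (1 : ℝ)) : Euc n × Euc n)‖ = 1 := by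
    simp [Prod.norm_def]
  simp only [fderiv_comp_prodMk_left hfd]
  rw [hGA, dual_operator_eq hylt hfd (hu3 _ hxΩ) hv3
    (Filter.mem_of_superset hnhds fun z hz => (hinv z hz).2.2.2)
    (Filter.mem_of_superset hnhds heq) hη rfl rfl rfl rfl rfl]
  exact sum_le_mul_trace (DS := fun k i j => fderiv ℝ (fun z => Smat z i j) y
    (EuclideanSpace.single k 1)) hn0 hylt hsym hσ hM hK ha₀0 (hSσ y hyc).1 (hSσ y hyc).2
    (fun i j => abs_fderiv_fderiv_le_of_norm_le hη2 (hl i) (hl j))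
    (fun i j => abs_fderiv_fderiv_le_of_norm_le hη2 (hl i) (hr j))
    (fun i j => abs_fderiv_fderiv_le_of_norm_le hη2 (hr i) (hl j))
    (fun i j => abs_fderiv_fderiv_le_of_norm_le hη2 (hr i) (hr j))
    (fun i => abs_fderiv_le_of_norm_le hη1 (hr i)) (fun i => abs_fderiv_le_of_norm_le hη1 (hl i))
    (fun i => abs_fderiv_le_of_norm_le hf1 (hl i)) (fun i => abs_fderiv_le_of_norm_le hf1 (hr i))
    hlow

end
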